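/- Let x ∈ Σ be a sequence that is not eventually constant, and set ξ := π_S(x). Then: (1) if limsup_{n→∞} e^{S_nχ(x)} = ∞, then limsup_{η→ξ} D_Θ(ξ,η) = ∞; (2) if liminf_{n→∞} e^{S_nχ(x)} = 0, then liminf_{η→ξ} D_Θ(ξ,η) = 0. -/

import Mathlib

open Set Filter Topology

noncomputable section

/-- The unit interval `𝒰 = [0,1]`. -/
abbrev UI : Set ℝ := Set.Icc 0 1

/-- An expanding piecewise `C^{1+ε}` map of the unit interval, presented through its
`d` increasing full inverse branches (ordered left to right, images covering `𝒰` with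
pairwise disjoint interiors), each branch being a `C^{1+ε}` diffeomorphism onto its image
whose derivative is `ε`-Hölder continuous with values in `(0,1)`. -/
structure ExpMap (d : ℕ) (ε : ℝ) : Type where
  toFun : ℝ → ℝ
  branch : Fin d → ℝ → ℝ
  branchDeriv : Fin d → ℝ → ℝ
  maps_to : Set.MapsTo toFun UI UI
  branch_maps_to : ∀ a, Set.MapsTo (branch a) UI UI
  branch_mono : ∀ a, StrictMonoOn (branch a) UI
  right_inv : ∀ a, ∀ ξ ∈ Set.Ico (0 : ℝ) 1, toFun (branch a ξ) = ξ
  map_one : toFun 1 = 1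
  branch_hasDeriv : ∀ a, ∀ ξ ∈ UI, HasDerivWithinAt (branch a) (branchDeriv a ξ) UI ξ
  branchDeriv_mem : ∀ a, ∀ ξ ∈ UI, branchDeriv a ξ ∈ Set.Ioo (0 : ℝ) 1
  branchDeriv_holder : ∀ a, ∃ C > 0, ∀ ξ ∈ UI, ∀ η ∈ UI,
      |branchDeriv a ξ - branchDeriv a η| ≤ C * |ξ - η| ^ ε
  ordered : ∀ a b : Fin d, a < b → ∀ ξ ∈ UI, ∀ η ∈ UI, branch a ξ ≤ branch b η
  cover : UI ⊆ ⋃ a, branch a '' UI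

/-- The shift map on `Σ = {1,…,d}^ℕ` (`x n` represents the letter `x_{n+1}`). -/
def shift {d : ℕ} (x : ℕ → Fin d) : ℕ → Fin d := fun n => x (n + 1)

/-- The cylinder set `[x_1 … x_n]`. -/
def cyl {d : ℕ} (x : ℕ → Fin d) (n : ℕ) : Set (ℕ → Fin d) := {y | ∀ m < n, y m = x m}

/-- Finite approximations `S_{x_1}^{-1} ∘ ⋯ ∘ S_{x_n}^{-1}(0)` to the coding map. -/
def approx {d : ℕ} {ε : ℝ} (S : ExpMap d ε) (x : ℕ → Fin d) (n : ℕ) : ℝ :=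
  (List.range n).foldr (fun m ξ => S.branch (x m) ξ) 0

/-- The coding map `π_S : Σ → 𝒰`. -/
def proj {d : ℕ} {ε : ℝ} (S : ExpMap d ε) (x : ℕ → Fin d) : ℝ := ⨆ n, approx S x n

/-- The potential `φ(x) = log (S_{x_1}^{-1})'(π_S(σ x))` associated with `S`. -/
def pot {d : ℕ} {ε : ℝ} (S : ExpMap d ε) (x : ℕ → Fin d) : ℝ :=
  Real.log (S.branchDeriv (x 0) (proj S (shift x)))

/-- Birkhoff sums `S_n f(x) = ∑_{m=0}^{n-1} f(σ^m x)`. -/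
def birk {d : ℕ} (f : (ℕ → Fin d) → ℝ) (n : ℕ) (x : ℕ → Fin d) : ℝ :=
  ∑ m ∈ Finset.range n, f (shift^[m] x)

/-- The difference quotient `D_Θ(ξ, η) = (Θ(ξ) - Θ(η))/(ξ - η)`. -/
def DQ (Θ : ℝ → ℝ) (ξ η : ℝ) : ℝ := (Θ ξ - Θ η) / (ξ - η)

/-- `Θ` is the conjugacy between `S` and `T` : an increasing homeomorphism of `𝒰`
with `T ∘ Θ = Θ ∘ S`. -/
def IsConjugacy {d : ℕ} {ε : ℝ} (S T : ExpMap d ε) (Θ : ℝ → ℝ) : Prop :=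
  StrictMonoOn Θ UI ∧ ContinuousOn Θ UI ∧ Θ '' UI = UI ∧
    ∀ ξ ∈ UI, T.toFun (Θ ξ) = Θ (S.toFun ξ)

/-- `x` has an `i`-block of length `k` at the `n`-th level:
`x_{n+1} = ⋯ = x_{n+k} = i` and `x_{n+k+1} ≠ i`. -/
def HasBlock {d : ℕ} (x : ℕ → Fin d) (i : Fin d) (k n : ℕ) : Prop :=
  (∀ m < k, x (n + m) = i) ∧ x (n + k) ≠ i

/-- `x` is eventually constant. -/
def EvConst {d : ℕ} (x : ℕ → Fin d) : Prop := ∃ N : ℕ, ∃ i : Fin d, ∀ n ≥ N, x n = i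

/-- `Θ'(ξ)` exists in the generalised sense: `lim_{η→ξ} D_Θ(ξ,η)` exists in `[0,∞]`
(with one-sided limits at the boundary points). -/
def GenDeriv (Θ : ℝ → ℝ) (ξ : ℝ) : Prop :=
  (∃ L : ℝ, Filter.Tendsto (fun η => DQ Θ ξ η) (nhdsWithin ξ (UI \ {ξ})) (nhds L)) ∨
    Filter.Tendsto (fun η => DQ Θ ξ η) (nhdsWithin ξ (UI \ {ξ})) Filter.atTop

namespace ExpMap

variable {d : ℕ} {ε : ℝ}

theorem branch_continuousOn (S : ExpMap d ε) (a : Fin d) : ContinuousOn (S.branch a) UI :=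
  fun ξ hξ => (S.branch_hasDeriv a ξ hξ).continuousWithinAt

theorem branchDeriv_continuousOn (S : ExpMap d ε) (hε : 0 < ε) (a : Fin d) :
    ContinuousOn (S.branchDeriv a) UI := by
  obtain ⟨C, -, hC⟩ := S.branchDeriv_holder a
  intro ξ hξ
  have hcont : Continuous fun η : ℝ => C * |η - ξ| ^ ε := by
    refine continuous_const.mul (Continuous.rpow_const (by fun_prop) fun _ => Or.inr hε.le)
  have hlim : Tendsto (fun η : ℝ => C * |η - ξ| ^ ε) (𝓝[UI] ξ) (𝓝 0) := by
    have := (hcont.tendsto ξ).mono_left (nhdsWithin_le_nhds (s := UI))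
    simpa [Real.zero_rpow hε.ne'] using this
  refine tendsto_iff_norm_sub_tendsto_zero.2 (squeeze_zero' ?_ ?_ hlim)
  · exact Eventually.of_forall fun _ => norm_nonneg _
  · filter_upwards [self_mem_nhdsWithin] with η hη using hC η hη ξ hξ

/-- The derivatives of the inverse branches are uniformly bounded away from `1`. -/
theorem exists_contraction (S : ExpMap d ε) (hε : 0 < ε) :
    ∃ l, 0 < l ∧ l < 1 ∧ ∀ a, ∀ ξ ∈ UI, S.branchDeriv a ξ ≤ l := by
  have h : ∀ a, ∀ᶠ l in 𝓝[<] (1 : ℝ), ∀ ξ ∈ UI, S.branchDeriv a ξ ≤ l := by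
    intro a
    obtain ⟨ξ₀, hξ₀, hmax⟩ := isCompact_Icc.exists_isMaxOn (nonempty_Icc.2 zero_le_one)
      (S.branchDeriv_continuousOn hε a)
    filter_upwards [Ioo_mem_nhdsLT (S.branchDeriv_mem a ξ₀ hξ₀).2] with l hl ξ hξ
    exact (hmax hξ).trans hl.1.le
  obtain ⟨l, hl, hl01⟩ :=
    ((eventually_all.2 h).and (Ioo_mem_nhdsLT (zero_lt_one' ℝ))).exists
  exact ⟨l, hl01.1, hl01.2, hl⟩

/-- The logarithms of the derivatives of the inverse branches are uniformly Hölder. -/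
theorem exists_log_holder (S : ExpMap d ε) (hε : 0 < ε) :
    ∃ C, 0 ≤ C ∧ ∀ a, ∀ ξ ∈ UI, ∀ η ∈ UI,
      |Real.log (S.branchDeriv a ξ) - Real.log (S.branchDeriv a η)| ≤ C * |ξ - η| ^ ε := by
  have h : ∀ a, ∃ C, ∀ ξ ∈ UI, ∀ η ∈ UI,
      |Real.log (S.branchDeriv a ξ) - Real.log (S.branchDeriv a η)| ≤ C * |ξ - η| ^ ε := by
    intro a
    obtain ⟨ξ₀, hξ₀, hmin⟩ := isCompact_Icc.exists_isMinOn (nonempty_Icc.2 zero_le_one)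
      (S.branchDeriv_continuousOn hε a)
    obtain ⟨C, -, hC⟩ := S.branchDeriv_holder a
    have hm := (S.branchDeriv_mem a ξ₀ hξ₀).1
    have key : ∀ ξ ∈ UI, ∀ η ∈ UI,
        Real.log (S.branchDeriv a ξ) - Real.log (S.branchDeriv a η) ≤
          C / S.branchDeriv a ξ₀ * |ξ - η| ^ ε := by
      intro ξ hξ η hη
      have hp := (S.branchDeriv_mem a ξ hξ).1
      have hq := (S.branchDeriv_mem a η hη).1
      rw [← Real.log_div hp.ne' hq.ne']
      calc Real.log (S.branchDeriv a ξ / S.branchDeriv a η)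
          ≤ S.branchDeriv a ξ / S.branchDeriv a η - 1 :=
            Real.log_le_sub_one_of_pos (div_pos hp hq)
        _ = (S.branchDeriv a ξ - S.branchDeriv a η) / S.branchDeriv a η := by
            field_simp
        _ ≤ |S.branchDeriv a ξ - S.branchDeriv a η| / S.branchDeriv a η := by
            gcongr; exact le_abs_self _
        _ ≤ |S.branchDeriv a ξ - S.branchDeriv a η| / S.branchDeriv a ξ₀ := by
            gcongr; exact hmin hη
        _ ≤ C * |ξ - η| ^ ε / S.branchDeriv a ξ₀ := by
            gcongr; exact hC ξ hξ η hη
        _ = C / S.branchDeriv a ξ₀ * |ξ - η| ^ ε := by ring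
    refine ⟨C / S.branchDeriv a ξ₀, fun ξ hξ η hη => abs_sub_le_iff.2 ⟨key ξ hξ η hη, ?_⟩⟩
    rw [abs_sub_comm ξ η]
    exact key η hη ξ hξ
  choose C hC using h
  obtain ⟨M, hM⟩ := Finite.exists_le C
  refine ⟨max M 0, le_max_right _ _, fun a ξ hξ η hη => (hC a ξ hξ η hη).trans ?_⟩
  gcongr
  exact (hM a).trans (le_max_left _ _)

/-- Mean value theorem for the inverse branches. -/
theorem exists_branchDeriv_eq_slope (S : ExpMap d ε) (a : Fin d) {u v : ℝ} (hu : u ∈ UI)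
    (hv : v ∈ UI) (huv : u ≠ v) :
    ∃ w ∈ UI, |w - v| ≤ |u - v| ∧
      S.branchDeriv a w = (S.branch a u - S.branch a v) / (u - v) := by
  have key : ∀ u ∈ UI, ∀ v ∈ UI, u < v → ∃ w ∈ Ioo u v,
      S.branchDeriv a w = (S.branch a v - S.branch a u) / (v - u) := by
    intro u hu v hv huv
    refine exists_hasDerivAt_eq_slope _ _ huv
      ((S.branch_continuousOn a).mono (Icc_subset_Icc hu.1 hv.2)) fun w hw => ?_
    have hw' : w ∈ Ioo (0 : ℝ) 1 := ⟨hu.1.trans_lt hw.1, hw.2.trans_le hv.2⟩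
    exact (S.branch_hasDeriv a w (Ioo_subset_Icc_self hw')).hasDerivAt
      (Icc_mem_nhds hw'.1 hw'.2)
  rcases huv.lt_or_gt with h | h
  · obtain ⟨w, hw, hs⟩ := key u hu v hv h
    refine ⟨w, ⟨hu.1.trans hw.1.le, hw.2.le.trans hv.2⟩, ?_, ?_⟩
    · rw [abs_of_neg (by linarith [hw.2]), abs_of_neg (by linarith)]
      linarith [hw.1]
    · rw [hs, ← neg_div_neg_eq, neg_sub, neg_sub]
  · obtain ⟨w, hw, hs⟩ := key v hv u hu h
    refine ⟨w, ⟨hv.1.trans hw.1.le, hw.2.le.trans hu.2⟩, ?_, hs⟩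
    rw [abs_of_pos (by linarith [hw.1]), abs_of_pos (by linarith)]
    linarith [hw.2]

/-- The composition `S_{x_1}^{-1} ∘ ⋯ ∘ S_{x_n}^{-1}`. -/
def cylMap (S : ExpMap d ε) : (ℕ → Fin d) → ℕ → ℝ → ℝ
  | _, 0, u => u
  | x, n + 1, u => S.branch (x 0) (cylMap S (shift x) n u)

theorem cylMap_mem (S : ExpMap d ε) (x : ℕ → Fin d) (n : ℕ) {u : ℝ} (hu : u ∈ UI) :
    S.cylMap x n u ∈ UI := by
  induction n generalizing x with
  | zero => exact hu
  | succ n ih => exact S.branch_maps_to _ (ih _)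

theorem approx_succ (S : ExpMap d ε) (x : ℕ → Fin d) (n : ℕ) :
    approx S x (n + 1) = S.branch (x 0) (approx S (shift x) n) := by
  simp [approx, List.range_succ_eq_map, List.foldr_map, shift]

theorem approx_mem (S : ExpMap d ε) (x : ℕ → Fin d) (n : ℕ) : approx S x n ∈ UI := by
  induction n generalizing x with
  | zero => simp [approx]
  | succ n ih => rw [approx_succ]; exact S.branch_maps_to _ (ih _)

theorem approx_mono (S : ExpMap d ε) (x : ℕ → Fin d) : Monotone (approx S x) := by
  refine monotone_nat_of_le_succ fun n => ?_
  induction n generalizing x with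
  | zero => exact (S.approx_mem x 1).1
  | succ n ih =>
    rw [approx_succ, approx_succ S x (n + 1)]
    exact (S.branch_mono _).monotoneOn (S.approx_mem _ _) (S.approx_mem _ _) (ih _)

theorem tendsto_approx (S : ExpMap d ε) (x : ℕ → Fin d) :
    Tendsto (approx S x) atTop (𝓝 (proj S x)) :=
  tendsto_atTop_ciSup (S.approx_mono x) ⟨1, by rintro _ ⟨n, rfl⟩; exact (S.approx_mem x n).2⟩

theorem proj_mem (S : ExpMap d ε) (x : ℕ → Fin d) : proj S x ∈ UI :=
  isClosed_Icc.mem_of_tendsto (S.tendsto_approx x) (Eventually.of_forall (S.approx_mem x))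

theorem tendsto_comp_approx (S : ExpMap d ε) (x : ℕ → Fin d) {f : ℝ → ℝ}
    (hf : ContinuousOn f UI) : Tendsto (fun n => f (approx S x n)) atTop (𝓝 (f (proj S x))) :=
  (hf _ (S.proj_mem x)).tendsto.comp (tendsto_nhdsWithin_iff.2
    ⟨S.tendsto_approx x, Eventually.of_forall (S.approx_mem x)⟩)

theorem branch_proj_shift (S : ExpMap d ε) (x : ℕ → Fin d) :
    S.branch (x 0) (proj S (shift x)) = proj S x := by
  refine tendsto_nhds_unique (S.tendsto_comp_approx (shift x) (S.branch_continuousOn (x 0))) ?_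
  simpa only [approx_succ] using (tendsto_add_atTop_iff_nat 1).2 (S.tendsto_approx x)

theorem cylMap_proj (S : ExpMap d ε) (x : ℕ → Fin d) (n : ℕ) :
    S.cylMap x n (proj S (shift^[n] x)) = proj S x := by
  induction n generalizing x with
  | zero => rfl
  | succ n ih =>
    rw [Function.iterate_succ_apply, cylMap, ih, branch_proj_shift]

theorem abs_cylMap_sub_le (S : ExpMap d ε) {l : ℝ} (hl0 : 0 < l)
    (hl : ∀ a, ∀ ξ ∈ UI, S.branchDeriv a ξ ≤ l) (x : ℕ → Fin d) (n : ℕ) {u v : ℝ}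
    (hu : u ∈ UI) (hv : v ∈ UI) : |S.cylMap x n u - S.cylMap x n v| ≤ l ^ n := by
  induction n generalizing x with
  | zero => simpa [cylMap] using abs_sub_le_of_le_of_le hu.1 hu.2 hv.1 hv.2
  | succ n ih =>
    have hu' := S.cylMap_mem (shift x) n hu
    have hv' := S.cylMap_mem (shift x) n hv
    simp only [cylMap]
    rcases eq_or_ne (S.cylMap (shift x) n u) (S.cylMap (shift x) n v) with h | h
    · simp only [h, sub_self, abs_zero]; positivity
    obtain ⟨w, hw, -, hs⟩ := S.exists_branchDeriv_eq_slope (x 0) hu' hv' h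
    rw [eq_div_iff (sub_ne_zero.2 h)] at hs
    rw [← hs, abs_mul, abs_of_pos (S.branchDeriv_mem _ _ hw).1, pow_succ']
    exact mul_le_mul (hl _ _ hw) (ih _) (abs_nonneg _) hl0.le

/-- Bounded distortion along cylinders. -/
theorem exists_distortion (S : ExpMap d ε) (hε : 0 < ε) :
    ∃ K, ∀ (x : ℕ → Fin d) (n : ℕ), ∀ u ∈ UI, u ≠ proj S (shift^[n] x) →
      0 < (S.cylMap x n u - proj S x) / (u - proj S (shift^[n] x)) ∧
      |Real.log ((S.cylMap x n u - proj S x) / (u - proj S (shift^[n] x))) -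
        birk (pot S) n x| ≤ K := by
  obtain ⟨l, hl0, hl1, hl⟩ := S.exists_contraction hε
  obtain ⟨C, hC0, hC⟩ := S.exists_log_holder hε
  have hr0 : 0 ≤ l ^ ε := by positivity
  have hr1 : l ^ ε < 1 := Real.rpow_lt_one hl0.le hl1 hε
  have key : ∀ (n : ℕ) (x : ℕ → Fin d), ∀ u ∈ UI, u ≠ proj S (shift^[n] x) →
      0 < (S.cylMap x n u - proj S x) / (u - proj S (shift^[n] x)) ∧
      |Real.log ((S.cylMap x n u - proj S x) / (u - proj S (shift^[n] x))) -
        birk (pot S) n x| ≤ C * ∑ m ∈ Finset.range n, (l ^ ε) ^ m := by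
    intro n
    induction n with
    | zero =>
      intro x u _ h
      have h1 : (S.cylMap x 0 u - proj S x) / (u - proj S (shift^[0] x)) = 1 :=
        div_self (sub_ne_zero.2 h)
      rw [h1]
      simp [birk]
    | succ n ih =>
      intro x u hu h
      rw [Function.iterate_succ_apply] at h ⊢
      obtain ⟨hpos, hlog⟩ := ih (shift x) u hu h
      set v := S.cylMap (shift x) n u with hv
      set p := proj S (shift x) with hp
      set q := proj S (shift^[n] (shift x)) with hq
      have hvp : v ≠ p := by
        rintro h0
        simp [h0] at hpos
      have hdist : |v - p| ≤ l ^ n := by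
        have := S.abs_cylMap_sub_le hl0 hl (shift x) n hu (S.proj_mem (shift^[n] (shift x)))
        rwa [cylMap_proj] at this
      obtain ⟨w, hw, hwp, hs⟩ := S.exists_branchDeriv_eq_slope (x 0)
        (S.cylMap_mem (shift x) n hu) (S.proj_mem (shift x)) hvp
      have hsplit : (S.cylMap x (n + 1) u - proj S x) / (u - q) =
          S.branchDeriv (x 0) w * ((v - p) / (u - q)) := by
        rw [hs, cylMap, ← branch_proj_shift S x, ← hv, ← hp,
          div_mul_div_cancel₀ (sub_ne_zero.2 hvp)]
      have hwpos := (S.branchDeriv_mem (x 0) w hw).1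
      rw [hsplit]
      refine ⟨mul_pos hwpos hpos, ?_⟩
      have hbirk : birk (pot S) (n + 1) x = pot S x + birk (pot S) n (shift x) := by
        simp [birk, Finset.sum_range_succ', add_comm]
      rw [Real.log_mul hwpos.ne' hpos.ne', hbirk, Finset.sum_range_succ, mul_add]
      have hfirst : |Real.log (S.branchDeriv (x 0) w) - pot S x| ≤ C * (l ^ ε) ^ n := by
        refine (hC _ w hw p (S.proj_mem _)).trans ?_
        rw [← Real.rpow_natCast, ← Real.rpow_mul hl0.le, mul_comm ε, Real.rpow_mul hl0.le,
          Real.rpow_natCast]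
        gcongr
        exact hwp.trans hdist
      rw [abs_le] at *
      constructor <;> linarith [hfirst.1, hfirst.2, hlog.1, hlog.2]
  refine ⟨C * (1 - l ^ ε)⁻¹, fun x n u hu h => ⟨(key n x u hu h).1, (key n x u hu h).2.trans ?_⟩⟩
  gcongr
  rw [← tsum_geometric_of_lt_one hr0 hr1]
  exact (summable_geometric_of_lt_one hr0 hr1).sum_le_tsum _ fun _ _ => by positivity

theorem exists_branch_eq (S : ExpMap d ε) {η : ℝ} (hη : η ∈ Ico (0 : ℝ) 1) :
    ∃ b, ∃ ζ ∈ Ico (0 : ℝ) 1, S.branch b ζ = η := by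
  have h0 : (0 : ℝ) ∈ UI := ⟨le_rfl, zero_le_one⟩
  have h1 : (1 : ℝ) ∈ UI := ⟨zero_le_one, le_rfl⟩
  have hle : ∀ b, ∀ ζ ∈ UI, S.branch b ζ ≤ S.branch b 1 := fun b ζ hζ =>
    (S.branch_mono b).monotoneOn hζ h1 hζ.2
  have hge : ∀ b, ∀ ζ ∈ UI, S.branch b 0 ≤ S.branch b ζ := fun b ζ hζ =>
    (S.branch_mono b).monotoneOn h0 hζ hζ.1
  obtain ⟨b₁, ζ₁, hζ₁, hb₁⟩ := mem_iUnion.1 (S.cover h1)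
  obtain ⟨b, hb, hmin⟩ := (Set.toFinite {b | η < S.branch b 1}).exists_minimal
    ⟨b₁, hη.2.trans_le (hb₁ ▸ hle b₁ ζ₁ hζ₁)⟩
  have hb0 : S.branch b 0 ≤ η := by
    by_contra! hlt
    have hm : (η + S.branch b 0) / 2 ∈ UI := by
      have := (S.branch_maps_to b h0).2
      constructor <;> linarith [hη.1, hη.2]
    obtain ⟨b₂, ζ₂, hζ₂, hb₂⟩ := mem_iUnion.1 (S.cover hm)
    have hb₂' : η < S.branch b₂ 1 := by linarith [hle b₂ ζ₂ hζ₂]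
    have hbb : b ≤ b₂ := by
      rcases le_total b b₂ with h | h
      · exact h
      · exact hmin hb₂' h
    rcases hbb.eq_or_lt with rfl | h
    · linarith [hge b ζ₂ hζ₂]
    · linarith [S.ordered b b₂ h 0 h0 ζ₂ hζ₂]
  obtain ⟨ζ, hζ, rfl⟩ := intermediate_value_Icc zero_le_one (S.branch_continuousOn b)
    ⟨hb0, le_of_lt hb⟩
  refine ⟨b, ζ, ⟨hζ.1, hζ.2.lt_of_ne ?_⟩, rfl⟩
  rintro rfl
  exact lt_irrefl (S.branch b 1) hb

end ExpMap

namespace IsConjugacy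

variable {d : ℕ} {ε : ℝ} {S T : ExpMap d ε} {Θ : ℝ → ℝ}

theorem mapsTo (hΘ : IsConjugacy S T Θ) : MapsTo Θ UI UI :=
  mapsTo_iff_image_subset.2 hΘ.2.2.1.subset

theorem map_zero (hΘ : IsConjugacy S T Θ) : Θ 0 = 0 := by
  have h0 : (0 : ℝ) ∈ UI := ⟨le_rfl, zero_le_one⟩
  obtain ⟨t, ht, ht0⟩ := hΘ.2.2.1.symm.subset h0
  exact le_antisymm ((hΘ.1.monotoneOn h0 ht ht.1).trans ht0.le) (hΘ.mapsTo h0).1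

theorem map_one (hΘ : IsConjugacy S T Θ) : Θ 1 = 1 := by
  have h1 : (1 : ℝ) ∈ UI := ⟨zero_le_one, le_rfl⟩
  obtain ⟨t, ht, ht1⟩ := hΘ.2.2.1.symm.subset h1
  exact le_antisymm (hΘ.mapsTo h1).2 (ht1.symm.le.trans (hΘ.1.monotoneOn ht h1 ht.2))

theorem map_branch_of_lt (hΘ : IsConjugacy S T Θ) (a : Fin d) {ξ : ℝ}
    (hξ : ξ ∈ Ico (0 : ℝ) 1) : Θ (S.branch a ξ) = T.branch a (Θ ξ) := by
  have h0 : (0 : ℝ) ∈ UI := ⟨le_rfl, zero_le_one⟩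
  have h0' : (0 : ℝ) ∈ Ico (0 : ℝ) 1 := ⟨le_rfl, zero_lt_one⟩
  have h1 : (1 : ℝ) ∈ UI := ⟨zero_le_one, le_rfl⟩
  have hlt : ∀ (R : ExpMap d ε) (a b : Fin d), a < b → ∀ ξ ∈ Ico (0 : ℝ) 1,
      R.branch a ξ < R.branch b 0 := fun R a b hab ξ hξ =>
    (R.branch_mono a (Ico_subset_Icc_self hξ) h1 hξ.2).trans_le (R.ordered a b hab 1 h1 0 h0)
  have hex : ∀ a : Fin d, ∀ ξ ∈ Ico (0 : ℝ) 1,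
      ∃ b, Θ ξ ∈ Ico (0 : ℝ) 1 ∧ Θ (S.branch a ξ) = T.branch b (Θ ξ) := by
    intro a ξ hξ
    have hξ' := Ico_subset_Icc_self hξ
    have hS := S.branch_maps_to a hξ'
    have hlt1 : S.branch a ξ < 1 :=
      (S.branch_mono a hξ' h1 hξ.2).trans_le (S.branch_maps_to a h1).2
    obtain ⟨b, ζ, hζ, hb⟩ := T.exists_branch_eq (η := Θ (S.branch a ξ))
      ⟨(hΘ.mapsTo hS).1, hΘ.map_one ▸ hΘ.1 hS h1 hlt1⟩
    have hconj := hΘ.2.2.2 _ hS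
    rw [← hb, T.right_inv b ζ hζ, S.right_inv a ξ hξ] at hconj
    exact ⟨b, hconj ▸ hζ, by rw [← hb, hconj]⟩
  choose f hf using fun a => hex a 0 h0'
  simp only [hΘ.map_zero] at hf
  have hfmono : StrictMono f := by
    intro a b hab
    by_contra! hba
    have h := hΘ.1 (S.branch_maps_to a h0) (S.branch_maps_to b h0) (hlt S a b hab 0 h0')
    rw [(hf a).2, (hf b).2] at h
    rcases hba.eq_or_lt with h' | h'
    · rw [h'] at h
      exact lt_irrefl _ h
    · exact lt_asymm h (hlt T _ _ h' 0 h0')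
  have hfid : ∀ a, f a = a := fun a =>
    le_antisymm hfmono.apply_le hfmono.le_apply
  have hzero : ∀ a, Θ (S.branch a 0) = T.branch a 0 := fun a => by
    rw [(hf a).2, hfid]
  obtain ⟨b, hΘξ, hb⟩ := hex a ξ hξ
  have hξ' := Ico_subset_Icc_self hξ
  rcases lt_trichotomy b a with h | rfl | h
  · have h2 := hΘ.1.monotoneOn (S.branch_maps_to a h0) (S.branch_maps_to a hξ')
      ((S.branch_mono a).monotoneOn h0 hξ' hξ.1)
    rw [hzero, hb] at h2
    exact absurd (hlt T b a h _ hΘξ) h2.not_gt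
  · exact hb
  · have h2 := hΘ.1 (S.branch_maps_to a hξ') (S.branch_maps_to b h0) (hlt S a b h ξ hξ)
    rw [hzero, hb] at h2
    exact absurd ((T.branch_mono b).monotoneOn h0 (Ico_subset_Icc_self hΘξ) hΘξ.1) h2.not_ge

theorem map_branch (hΘ : IsConjugacy S T Θ) (a : Fin d) {ξ : ℝ} (hξ : ξ ∈ UI) :
    Θ (S.branch a ξ) = T.branch a (Θ ξ) := by
  have hcl : closure (Ico (0 : ℝ) 1) = UI := closure_Ico zero_ne_one
  have hS : ContinuousOn (fun ξ => Θ (S.branch a ξ)) UI :=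
    hΘ.2.1.comp (S.branch_continuousOn a) (S.branch_maps_to a)
  have hT : ContinuousOn (fun ξ => T.branch a (Θ ξ)) UI :=
    (T.branch_continuousOn a).comp hΘ.2.1 hΘ.mapsTo
  have heq : EqOn (fun ξ => Θ (S.branch a ξ)) (fun ξ => T.branch a (Θ ξ)) (Ico (0 : ℝ) 1) :=
    fun ξ hξ => hΘ.map_branch_of_lt a hξ
  exact heq.of_subset_closure hS hT Ico_subset_Icc_self hcl.symm.subset hξ

theorem map_cylMap (hΘ : IsConjugacy S T Θ) (x : ℕ → Fin d) (n : ℕ) {u : ℝ} (hu : u ∈ UI) :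
    Θ (S.cylMap x n u) = T.cylMap x n (Θ u) := by
  induction n generalizing x with
  | zero => rfl
  | succ n ih =>
    rw [ExpMap.cylMap, ExpMap.cylMap, hΘ.map_branch _ (S.cylMap_mem _ _ hu), ih]

theorem map_approx (hΘ : IsConjugacy S T Θ) (x : ℕ → Fin d) (n : ℕ) :
    Θ (approx S x n) = approx T x n := by
  induction n generalizing x with
  | zero => simpa [approx] using hΘ.map_zero
  | succ n ih =>
    rw [ExpMap.approx_succ, ExpMap.approx_succ, hΘ.map_branch _ (S.approx_mem _ _), ih]

theorem map_proj (hΘ : IsConjugacy S T Θ) (x : ℕ → Fin d) : Θ (proj S x) = proj T x := by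
  refine tendsto_nhds_unique (S.tendsto_comp_approx x hΘ.2.1) ?_
  simpa only [hΘ.map_approx] using T.tendsto_approx x

theorem exists_DQ_bound (hΘ : IsConjugacy S T Θ) :
    ∃ K, ∀ v ∈ UI, ∃ u ∈ UI, u ≠ v ∧ 0 < DQ Θ v u ∧ |Real.log (DQ Θ v u)| ≤ K := by
  have h0 : (0 : ℝ) ∈ UI := ⟨le_rfl, zero_le_one⟩
  have h1 : (1 : ℝ) ∈ UI := ⟨zero_le_one, le_rfl⟩
  have hh : (1 / 2 : ℝ) ∈ UI := by constructor <;> norm_num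
  have hpos : 0 < Θ (1 / 2) := hΘ.map_zero.symm.trans_lt (hΘ.1 h0 hh (by norm_num))
  have hlt : Θ (1 / 2) < 1 := (hΘ.1 hh h1 (by norm_num)).trans_eq hΘ.map_one
  obtain ⟨c, hc0, hc⟩ : ∃ c, 0 < c ∧ c ≤ Θ (1 / 2) ∧ c ≤ 1 - Θ (1 / 2) :=
    ⟨min (Θ (1 / 2)) (1 - Θ (1 / 2)), lt_min hpos (sub_pos.2 hlt), min_le_left _ _,
      min_le_right _ _⟩
  suffices h : ∀ v ∈ UI, ∃ u ∈ UI, u ≠ v ∧ c ≤ DQ Θ v u ∧ DQ Θ v u ≤ 2 by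
    refine ⟨|Real.log c| + |Real.log 2|, fun v hv => ?_⟩
    obtain ⟨u, hu, huv, hl, hr⟩ := h v hv
    refine ⟨u, hu, huv, hc0.trans_le hl, abs_le.2 ⟨?_, ?_⟩⟩
    · linarith [Real.log_le_log hc0 hl, neg_abs_le (Real.log c), abs_nonneg (Real.log 2)]
    · linarith [Real.log_le_log (hc0.trans_le hl) hr, le_abs_self (Real.log 2),
        abs_nonneg (Real.log c)]
  intro v hv
  have hΘv := hΘ.mapsTo hv
  rcases le_total v (1 / 2) with h | h
  · have hm := hΘ.1.monotoneOn hv hh h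
    have hv1 : 0 < 1 - v := by linarith
    refine ⟨1, h1, by linarith, ?_⟩
    have : DQ Θ v 1 = (1 - Θ v) / (1 - v) := by
      rw [DQ, hΘ.map_one, ← neg_div_neg_eq, neg_sub, neg_sub]
    rw [this, le_div_iff₀ hv1, div_le_iff₀ hv1]
    constructor <;> nlinarith [hv.1, hΘv.1]
  · have hm := hΘ.1.monotoneOn hh hv h
    have hv0 : 0 < v := by linarith
    refine ⟨0, h0, by linarith, ?_⟩
    have : DQ Θ v 0 = Θ v / v := by
      rw [DQ, hΘ.map_zero, sub_zero, sub_zero]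
    rw [this, le_div_iff₀ hv0, div_le_iff₀ hv0]
    constructor <;> nlinarith [hv.2, hΘv.2]

/-- At every level `n` there is a point close to `π_S(x)` at which the difference quotient of
the conjugacy is comparable to `e^{S_nχ(x)}`, uniformly in `n`. -/
theorem exists_DQ_comparable (hΘ : IsConjugacy S T Θ) (hε : 0 < ε) (x : ℕ → Fin d) :
    ∃ K, ∀ δ > 0, ∃ N, ∀ n ≥ N, ∃ η ∈ UI, η ≠ proj S x ∧ |η - proj S x| < δ ∧
      0 < DQ Θ (proj S x) η ∧
      |Real.log (DQ Θ (proj S x) η) - birk (fun z => pot T z - pot S z) n x| ≤ K := by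
  obtain ⟨l, hl0, hl1, hl⟩ := S.exists_contraction hε
  obtain ⟨KS, hKS⟩ := S.exists_distortion hε
  obtain ⟨KT, hKT⟩ := T.exists_distortion hε
  obtain ⟨K, hK⟩ := hΘ.exists_DQ_bound
  refine ⟨KS + KT + K, fun δ hδ => ?_⟩
  obtain ⟨N, hN⟩ := exists_pow_lt_of_lt_one hδ hl1
  refine ⟨N, fun n hn => ?_⟩
  obtain ⟨u, hu, huv, hpos, hlog⟩ := hK _ (S.proj_mem (shift^[n] x))
  obtain ⟨hSpos, hSlog⟩ := hKS x n u hu huv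
  have hΘuv : Θ u ≠ proj T (shift^[n] x) := by
    rw [← hΘ.map_proj]
    exact fun h => huv (hΘ.1.injOn hu (S.proj_mem _) h)
  obtain ⟨hTpos, hTlog⟩ := hKT x n (Θ u) (hΘ.mapsTo hu) hΘuv
  have hne : S.cylMap x n u ≠ proj S x := by
    intro h
    simp [h] at hSpos
  have hDQ : DQ Θ (proj S x) (S.cylMap x n u) =
      (T.cylMap x n (Θ u) - proj T x) / (Θ u - proj T (shift^[n] x)) /
        ((S.cylMap x n u - proj S x) / (u - proj S (shift^[n] x))) *
        DQ Θ (proj S (shift^[n] x)) u := by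
    have e1 := sub_ne_zero.2 hΘuv
    have e2 := sub_ne_zero.2 huv
    have e3 := sub_ne_zero.2 hne
    rw [DQ, DQ, hΘ.map_proj, hΘ.map_proj, hΘ.map_cylMap x n hu, ← neg_div_neg_eq, neg_sub, neg_sub,
      ← neg_div_neg_eq (proj T (shift^[n] x) - Θ u), neg_sub, neg_sub]
    field_simp
  refine ⟨_, S.cylMap_mem x n hu, hne, ?_, ?_, ?_⟩
  · have := S.abs_cylMap_sub_le hl0 hl x n hu (S.proj_mem (shift^[n] x))
    rw [ExpMap.cylMap_proj] at this
    exact (this.trans (pow_le_pow_of_le_one hl0.le hl1.le hn)).trans_lt hN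
  · rw [hDQ]
    exact mul_pos (div_pos hTpos hSpos) hpos
  · have hbirk : birk (fun z => pot T z - pot S z) n x =
        birk (pot T) n x - birk (pot S) n x := by
      simp [birk, Finset.sum_sub_distrib]
    rw [hDQ, Real.log_mul (div_pos hTpos hSpos).ne' hpos.ne', Real.log_div hTpos.ne' hSpos.ne',
      hbirk]
    rw [abs_le] at *
    constructor <;> linarith [hSlog.1, hSlog.2, hTlog.1, hTlog.2, hlog.1, hlog.2]

end IsConjugacy

/-- Lemma `der`.  For `x ∈ Σ` not eventually constant and `ξ := π_S(x)`:
(1) if `limsup_n e^{S_nχ(x)} = ∞` then `limsup_{η→ξ} D_Θ(ξ,η) = ∞`;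
(2) if `liminf_n e^{S_nχ(x)} = 0` then `liminf_{η→ξ} D_Θ(ξ,η) = 0`. -/
theorem statement_3 {d : ℕ} {ε : ℝ} (hd : 2 ≤ d) (hε : 0 < ε)
    (S T : ExpMap d ε) (Θ : ℝ → ℝ) (hΘ : IsConjugacy S T Θ)
    (x : ℕ → Fin d) (hx : ¬ EvConst x) :
    ((∀ M : ℝ, ∀ N : ℕ, ∃ n ≥ N, M < Real.exp (birk (fun z => pot T z - pot S z) n x)) →
      ∀ M : ℝ, ∀ δ > 0, ∃ η ∈ UI, η ≠ proj S x ∧ |η - proj S x| < δ ∧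
        M < DQ Θ (proj S x) η) ∧
    ((∀ e > 0, ∀ N : ℕ, ∃ n ≥ N, Real.exp (birk (fun z => pot T z - pot S z) n x) < e) →
      ∀ e > 0, ∀ δ > 0, ∃ η ∈ UI, η ≠ proj S x ∧ |η - proj S x| < δ ∧
        |DQ Θ (proj S x) η| < e) := by
  obtain ⟨K, hK⟩ := hΘ.exists_DQ_comparable hε x
  constructor
  · intro h M δ hδ
    obtain ⟨N, hN⟩ := hK δ hδ
    obtain ⟨n, hn, hM⟩ := h (M * Real.exp K) N
    obtain ⟨η, hη, hne, hηδ, hpos, hlog⟩ := hN n hn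
    refine ⟨η, hη, hne, hηδ, ?_⟩
    have hle : Real.exp (birk (fun z => pot T z - pot S z) n x) ≤
        DQ Θ (proj S x) η * Real.exp K := by
      rw [← Real.exp_log hpos, ← Real.exp_add, Real.exp_le_exp]
      linarith [(abs_le.1 hlog).1]
    exact lt_of_mul_lt_mul_right (hM.trans_le hle) (Real.exp_pos K).le
  · intro h e he δ hδ
    obtain ⟨N, hN⟩ := hK δ hδ
    obtain ⟨n, hn, hM⟩ := h (e * Real.exp (-K)) (by positivity) N
    obtain ⟨η, hη, hne, hηδ, hpos, hlog⟩ := hN n hn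
    refine ⟨η, hη, hne, hηδ, ?_⟩
    have hle : DQ Θ (proj S x) η * Real.exp (-K) ≤
        Real.exp (birk (fun z => pot T z - pot S z) n x) := by
      rw [← Real.exp_log hpos, ← Real.exp_add, Real.exp_le_exp]
      linarith [(abs_le.1 hlog).2]
    rw [abs_of_pos hpos]
    exact lt_of_mul_lt_mul_right (hle.trans_lt hM) (Real.exp_pos _).le
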